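/- arXiv:1801.09778 — 7 statements merged into one kernel-verified Lean document; each statement's English description precedes it below -/
import Mathlib

section
/- Assume ρ and γ are continuous, the kernel k is positive semidefinite (Q(ν) ≥ 0 for every signed discrete varifold ν), the kernel defined by ρ is C₀-universal, γ(1) > 0, and γ(u) < γ(1) for all u ∈ [−1,1). Then ‖·‖_{W*} induces a metric on 𝒟̊: for any two discrete varifolds μ, μ' ∈ 𝒟̊, if Q(μ−μ') = 0 then μ = μ' (they have the same atoms (x_i,d_i) with the same weights r_i). -/
open scoped RealInnerProductSpace

noncomputable section

/-- `ℝⁿ` as a Euclidean space. -/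
abbrev Euc (n : ℕ) : Type := EuclideanSpace ℝ (Fin n)

/-- The separable kernel `k((x,d),(x',d')) = ρ(|x-x'|²) γ(⟨d,d'⟩)` on `ℝⁿ × S^{n-1}`. -/
def kerF (n : ℕ) (ρ γ : ℝ → ℝ) (a b : Euc n × Euc n) : ℝ :=
  ρ (‖a.1 - b.1‖ ^ 2) * γ ⟪a.2, b.2⟫

/-- The kernel quadratic form `Q(ν) = Σ_{a,b} ν(a) ν(b) k(a,b)` of a signed discrete
varifold, encoded as a finitely supported function on `ℝⁿ × S^{n-1}`. -/
def Qform (n : ℕ) (ρ γ : ℝ → ℝ) (ν : (Euc n × Euc n) →₀ ℝ) : ℝ :=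
  ∑ a ∈ ν.support, ∑ b ∈ ν.support, ν a * ν b * kerF n ρ γ a b

/-- A signed discrete varifold: all atoms carry unit direction vectors. -/
def IsSignedVarifold (n : ℕ) (ν : (Euc n × Euc n) →₀ ℝ) : Prop :=
  ∀ a ∈ ν.support, ‖a.2‖ = 1

/-- A discrete varifold (element of `𝒟`): atoms `(xᵢ,dᵢ)` with unit directions and
positive weights. -/
def IsDiscreteVarifold (n : ℕ) (μ : (Euc n × Euc n) →₀ ℝ) : Prop :=
  ∀ a ∈ μ.support, 0 < μ a ∧ ‖a.2‖ = 1

/-- Element of `𝒟̊`: a discrete varifold whose positions are pairwise distinct (a single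
direction vector per point position). -/
def HasDistinctPositions (n : ℕ) (μ : (Euc n × Euc n) →₀ ℝ) : Prop :=
  ∀ a ∈ μ.support, ∀ b ∈ μ.support, a.1 = b.1 → a = b

/-- The bilinear form on finitely supported functions that a kernel `k` induces. -/
def kernelBilin {X : Type*} (k : X → X → ℝ) : (X →₀ ℝ) →ₗ[ℝ] (X →₀ ℝ) →ₗ[ℝ] ℝ :=
  Finsupp.linearCombination ℝ fun a => Finsupp.linearCombination ℝ (k a)

lemma kernelBilin_apply {X : Type*} (k : X → X → ℝ) (ν η : X →₀ ℝ) :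
    kernelBilin k ν η = ν.sum fun a s => s * η.sum fun b t => t * k a b := by
  simp [kernelBilin, Finsupp.linearCombination_apply, Finsupp.sum, LinearMap.sum_apply]

lemma kernelBilin_single_right {X : Type*} (k : X → X → ℝ) (ν : X →₀ ℝ) (p : X) :
    kernelBilin k ν (Finsupp.single p 1) = ν.sum fun a s => s * k a p := by
  simp [kernelBilin_apply]

lemma kernelBilin_comm {X : Type*} {k : X → X → ℝ} (hk : ∀ a b, k a b = k b a)
    (ν η : X →₀ ℝ) : kernelBilin k ν η = kernelBilin k η ν := by
  simp only [kernelBilin_apply, Finsupp.sum, Finset.mul_sum]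
  rw [Finset.sum_comm]
  refine Finset.sum_congr rfl fun b _ => Finset.sum_congr rfl fun a _ => ?_
  rw [hk a b]
  ring

lemma Qform_eq_kernelBilin (n : ℕ) (ρ γ : ℝ → ℝ) (ν : (Euc n × Euc n) →₀ ℝ) :
    Qform n ρ γ ν = kernelBilin (kerF n ρ γ) ν ν := by
  simp only [Qform, kernelBilin_apply, Finsupp.sum, Finset.mul_sum, mul_assoc]

lemma kerF_comm (n : ℕ) (ρ γ : ℝ → ℝ) (a b : Euc n × Euc n) :
    kerF n ρ γ a b = kerF n ρ γ b a := by
  rw [kerF, kerF, norm_sub_rev, real_inner_comm]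

lemma IsSignedVarifold.add_smul {n : ℕ} {ν η : (Euc n × Euc n) →₀ ℝ}
    (hν : IsSignedVarifold n ν) (hη : IsSignedVarifold n η) (t : ℝ) :
    IsSignedVarifold n (ν + t • η) := by
  classical
  intro a ha
  rcases Finset.mem_union.1 (Finsupp.support_add ha) with h | h
  · exact hν a h
  · exact hη a (Finsupp.support_smul h)

/-- A signed varifold of zero energy is orthogonal to every signed varifold. -/
lemma kernelBilin_eq_zero_of_Qform_eq_zero {n : ℕ} {ρ γ : ℝ → ℝ}
    (hpsd : ∀ ν : (Euc n × Euc n) →₀ ℝ, IsSignedVarifold n ν → 0 ≤ Qform n ρ γ ν)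
    {ν η : (Euc n × Euc n) →₀ ℝ} (hν : IsSignedVarifold n ν) (hη : IsSignedVarifold n η)
    (hQ : Qform n ρ γ ν = 0) : kernelBilin (kerF n ρ γ) ν η = 0 := by
  have hquad : ∀ t : ℝ, 0 ≤ kernelBilin (kerF n ρ γ) η η * (t * t) +
      (2 * kernelBilin (kerF n ρ γ) ν η) * t + 0 := by
    intro t
    have h := hpsd _ (hν.add_smul hη t)
    rw [Qform_eq_kernelBilin] at h hQ
    simp only [map_add, map_smul, LinearMap.add_apply, LinearMap.smul_apply, smul_eq_mul, hQ,
      kernelBilin_comm (kerF_comm n ρ γ) η ν] at h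
    linarith
  have hd := discrim_le_zero hquad
  rw [discrim] at hd
  have : kernelBilin (kerF n ρ γ) ν η ^ 2 ≤ 0 := by linarith
  exact pow_eq_zero_iff two_ne_zero |>.1 (le_antisymm this (sq_nonneg _))

/-- A finite combination of point evaluations that vanishes on the sections of a
`C₀`-universal kernel vanishes identically. -/
lemma Finsupp.sum_mul_zeroAtInfty_eq_zero {n : ℕ} {ρ : ℝ → ℝ}
    (huniv : Dense (X := ZeroAtInftyContinuousMap (Euc n) ℝ)
        (Submodule.span ℝ {g : ZeroAtInftyContinuousMap (Euc n) ℝ |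
            ∃ y : Euc n, ∀ x : Euc n, g x = ρ (‖x - y‖ ^ 2)} : Set _))
    {ν : (Euc n × Euc n) →₀ ℝ} {w : Euc n × Euc n → ℝ}
    (h : ∀ y : Euc n, ν.sum (fun a s => s * (ρ (‖a.1 - y‖ ^ 2) * w a)) = 0)
    (g : ZeroAtInftyContinuousMap (Euc n) ℝ) : ν.sum (fun a s => s * (g a.1 * w a)) = 0 := by
  have hcl : IsClosed {g : ZeroAtInftyContinuousMap (Euc n) ℝ |
      ν.sum (fun a s => s * (g a.1 * w a)) = 0} := by
    refine isClosed_eq ?_ continuous_const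
    refine continuous_finsetSum _ fun a _ =>
      continuous_const.mul (Continuous.mul ?_ continuous_const)
    exact (BoundedContinuousFunction.lipschitz_eval_const a.1).continuous.comp
      ZeroAtInftyContinuousMap.isometry_toBCF.continuous
  refine hcl.closure_subset_iff.2 ?_ (huniv g)
  intro f hf
  induction hf using Submodule.span_induction with
  | mem f hf =>
    obtain ⟨y, hy⟩ := hf
    simpa only [Set.mem_ofPred_eq, hy] using h y
  | zero => simp
  | add f₁ f₂ _ _ h₁ h₂ =>
    simp only [Set.mem_ofPred_eq, Finsupp.sum] at h₁ h₂ ⊢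
    simp only [ZeroAtInftyContinuousMap.add_apply, add_mul, mul_add, Finset.sum_add_distrib,
      h₁, h₂, add_zero]
  | smul c f _ h₁ =>
    simp only [Set.mem_ofPred_eq, Finsupp.sum] at h₁ ⊢
    have : ∀ a, ν a * ((c • f) a.1 * w a) = c * (ν a * (f a.1 * w a)) := fun a => by
      simp only [ZeroAtInftyContinuousMap.smul_apply, smul_eq_mul]; ring
    simp only [this, ← Finset.mul_sum, h₁, mul_zero]

/-- In a locally compact Hausdorff space, some function vanishing at infinity is `1` at a given
point and `0` at the other points of a given finite set. -/
lemma exists_zeroAtInfty_one_zero {X : Type*} [TopologicalSpace X] [T2Space X]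
    [LocallyCompactSpace X] (s : Finset X) (x : X) :
    ∃ g : ZeroAtInftyContinuousMap X ℝ, g x = 1 ∧ ∀ z ∈ s, z ≠ x → g z = 0 := by
  classical
  obtain ⟨f, hf1, hf0, hfc, -⟩ := exists_continuous_one_zero_of_isCompact
    (isCompact_singleton (x := x)) (s.erase x).finite_toSet.isClosed (by simp)
  refine ⟨⟨f, hfc.is_zero_at_infty⟩, hf1 rfl, fun z hz hzx => hf0 ?_⟩
  simp [hz, hzx]

/-- If two varifolds with distinct positions induce the same direction-weighted evaluations of
functions vanishing at infinity, then every atom of the first is an atom of the second, with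
the same weight. -/
lemma HasDistinctPositions.apply_eq_of_sum_eq {n : ℕ} {γ : ℝ → ℝ}
    (hγ1 : 0 < γ 1) (hγlt : ∀ u : ℝ, -1 ≤ u → u < 1 → γ u < γ 1)
    {μ μ' : (Euc n × Euc n) →₀ ℝ}
    (hμ : IsDiscreteVarifold n μ) (hμ' : IsDiscreteVarifold n μ')
    (hμpos : HasDistinctPositions n μ) (hμ'pos : HasDistinctPositions n μ')
    (h : ∀ e : Euc n, ‖e‖ = 1 → ∀ g : ZeroAtInftyContinuousMap (Euc n) ℝ,
      μ.sum (fun a s => s * (g a.1 * γ ⟪a.2, e⟫)) = μ'.sum (fun a s => s * (g a.1 * γ ⟪a.2, e⟫)))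
    {a : Euc n × Euc n} (ha : a ∈ μ.support) : μ a = μ' a := by
  classical
  obtain ⟨g, hg1, hg0⟩ :=
    exists_zeroAtInfty_one_zero ((μ.support ∪ μ'.support).image Prod.fst) a.1
  have hsum : ∀ (η : (Euc n × Euc n) →₀ ℝ), η.support ⊆ μ.support ∪ μ'.support →
      HasDistinctPositions n η → ∀ b ∈ η.support, b.1 = a.1 → ∀ e : Euc n,
      η.sum (fun a s => s * (g a.1 * γ ⟪a.2, e⟫)) = η b * γ ⟪b.2, e⟫ := by
    intro η hsub hη b hb hba e
    rw [Finsupp.sum, Finset.sum_eq_single_of_mem b hb, hba, hg1, one_mul]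
    intro c hc hcb
    rw [hg0 c.1 (Finset.mem_image_of_mem _ (hsub hc))
      fun hca => hcb (hη c hc b hb (hca.trans hba.symm))]
    simp
  have hself : ∀ d : Euc n, ‖d‖ = 1 → ⟪d, d⟫ = 1 := fun d hd => by
    rw [real_inner_self_eq_norm_sq, hd, one_pow]
  obtain ⟨hμa, ha1⟩ := hμ a ha
  have hL := hsum μ Finset.subset_union_left hμpos a ha rfl
  by_cases hex : ∃ b ∈ μ'.support, b.1 = a.1
  · obtain ⟨b, hb, hba⟩ := hex
    obtain ⟨hμb, hb1⟩ := hμ' b hb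
    have key : ∀ e : Euc n, ‖e‖ = 1 → μ a * γ ⟪a.2, e⟫ = μ' b * γ ⟪b.2, e⟫ := fun e he => by
      rw [← hL, ← hsum μ' Finset.subset_union_right hμ'pos b hb hba, h e he g]
    have h₁ := key a.2 ha1
    have h₂ := key b.2 hb1
    rw [hself _ ha1] at h₁
    rw [hself _ hb1, real_inner_comm] at h₂
    by_cases hdir : b.2 = a.2
    · obtain rfl : b = a := Prod.ext hba hdir
      rw [hself _ ha1] at h₁
      exact mul_right_cancel₀ hγ1.ne' h₁
    · have hlt := hγlt ⟪b.2, a.2⟫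
        (by simpa [ha1, hb1] using neg_le_of_abs_le (abs_real_inner_le_norm b.2 a.2))
        ((inner_lt_one_iff_real_of_norm_eq_one hb1 ha1).2 hdir)
      have h₃ := mul_lt_mul_of_pos_left hlt hμb
      have h₄ := mul_lt_mul_of_pos_left hlt hμa
      linarith
  · have hR : μ'.sum (fun b s => s * (g b.1 * γ ⟪b.2, a.2⟫)) = 0 := by
      refine Finset.sum_eq_zero fun b hb => ?_
      simp [hg0 b.1 (Finset.mem_image_of_mem _ (Finset.mem_union_right _ hb))
        fun hba => hex ⟨b, hb, hba⟩]
    have := h a.2 ha1 g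
    rw [hR, hL, hself _ ha1] at this
    exact absurd this (mul_pos hμa hγ1).ne'

/-- if `ρ`, `γ` are continuous, the kernel is positive semidefinite, the kernel
defined by `ρ` is `C₀`-universal, `γ(1) > 0` and `γ(u) < γ(1)` for `u ∈ [-1,1)`, then
`‖·‖_{W*}` induces a metric on `𝒟̊`: `Q(μ - μ') = 0` implies `μ = μ'`. -/
theorem stmt1 (n : ℕ) (hn : 1 ≤ n) (ρ γ : ℝ → ℝ)
    (hρc : Continuous ρ) (hγc : Continuous γ)
    (hpsd : ∀ ν : (Euc n × Euc n) →₀ ℝ, IsSignedVarifold n ν → 0 ≤ Qform n ρ γ ν)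
    -- `C₀`-universality of the kernel defined by `ρ`: every section `x ↦ ρ(|x-y|²)`
    -- vanishes at infinity, and the span of the sections is dense in `C₀(ℝⁿ,ℝ)`.
    (huniv₁ : ∀ y : Euc n, ∃ g : ZeroAtInftyContinuousMap (Euc n) ℝ,
        ∀ x : Euc n, g x = ρ (‖x - y‖ ^ 2))
    (huniv₂ : Dense (X := ZeroAtInftyContinuousMap (Euc n) ℝ)
        (Submodule.span ℝ {g : ZeroAtInftyContinuousMap (Euc n) ℝ |
            ∃ y : Euc n, ∀ x : Euc n, g x = ρ (‖x - y‖ ^ 2)} : Set _))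
    (hγ1 : 0 < γ 1) (hγlt : ∀ u : ℝ, -1 ≤ u → u < 1 → γ u < γ 1)
    (μ μ' : (Euc n × Euc n) →₀ ℝ)
    (hμ : IsDiscreteVarifold n μ) (hμ' : IsDiscreteVarifold n μ')
    (hμpos : HasDistinctPositions n μ) (hμ'pos : HasDistinctPositions n μ')
    (hQ : Qform n ρ γ (μ - μ') = 0) :
    μ = μ' := by
  classical
  have hν : IsSignedVarifold n (μ - μ') := by
    intro a ha
    rcases Finset.mem_union.1 (Finsupp.support_sub ha) with h | h
    · exact (hμ a h).2
    · exact (hμ' a h).2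
  have heq : ∀ e : Euc n, ‖e‖ = 1 → ∀ g : ZeroAtInftyContinuousMap (Euc n) ℝ,
      μ.sum (fun a s => s * (g a.1 * γ ⟪a.2, e⟫)) =
        μ'.sum (fun a s => s * (g a.1 * γ ⟪a.2, e⟫)) := by
    intro e he g
    rw [← sub_eq_zero, ← Finsupp.sum_sub_index fun _ _ _ => sub_mul _ _ _]
    refine Finsupp.sum_mul_zeroAtInfty_eq_zero (w := fun a => γ ⟪a.2, e⟫) huniv₂ (fun y => ?_) g
    have hη : IsSignedVarifold n (Finsupp.single (y, e) 1) := fun a ha => by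
      rw [Finset.mem_singleton.1 (Finsupp.support_single_subset ha), he]
    simpa only [kernelBilin_single_right, kerF] using
      kernelBilin_eq_zero_of_Qform_eq_zero hpsd hν hη hQ
  ext a
  by_cases ha : a ∈ μ.support
  · exact hμpos.apply_eq_of_sum_eq hγ1 hγlt hμ hμ' hμ'pos heq ha
  by_cases ha' : a ∈ μ'.support
  · exact (hμ'pos.apply_eq_of_sum_eq hγ1 hγlt hμ' hμ hμpos
      (fun e he g => (heq e he g).symm) ha').symm
  rw [Finsupp.notMem_support_iff.1 ha, Finsupp.notMem_support_iff.1 ha']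
end
end

section
/- Let γ be the linear kernel function γ(u) = u, and let ρ : [0,∞) → ℝ be arbitrary. Then for every x ∈ ℝⁿ: (a) for every d ∈ S^{n−1}, the signed discrete varifold δ_{(x,d)} + δ_{(x,−d)} pairs to zero with every kernel section and satisfies Q(δ_{(x,d)} + δ_{(x,−d)}) = 0; (b) for all d₁, d₂ ∈ S^{n−1} with d₁ ≠ −d₂, the signed discrete varifold δ_{(x,d₁)} + δ_{(x,d₂)} − |d₁+d₂| δ_{(x,(d₁+d₂)/|d₁+d₂|)} pairs to zero with every kernel section and its quadratic form Q vanishes. Hence the linear kernel yields only a pseudo-metric on the set of discrete varifolds. -/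
open scoped RealInnerProductSpace

noncomputable section

/-- Kernel quadratic form `Q(ν) = Σ_{i,j} cᵢ cⱼ k((xᵢ,dᵢ),(xⱼ,dⱼ))` of a signed discrete
varifold `ν = Σᵢ cᵢ δ_{(xᵢ,dᵢ)}`. -/
def QformF {n : ℕ} (ρ γ : ℝ → ℝ) {ι : Type} [Fintype ι]
    (a : ι → Euc n × Euc n) (c : ι → ℝ) : ℝ :=
  ∑ i, ∑ j, c i * c j * kerF n ρ γ (a i) (a j)

/-- If the vectors `d i` satisfy the linear relation `∑ i, c i • d i = 0`, then the varifold
`∑ i, c i δ_{(x, d i)}` pairs to zero with every section of the linear separable kernel. -/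
theorem sum_mul_kerF_linear_eq_zero {n : ℕ} (ρ : ℝ → ℝ) {ι : Type} [Fintype ι]
    (a : ι → Euc n × Euc n) (c : ι → ℝ) (x : Euc n) (hx : ∀ i, (a i).1 = x)
    (hc : ∑ i, c i • (a i).2 = 0) (b : Euc n × Euc n) :
    ∑ i, c i * kerF n ρ (fun u => u) (a i) b = 0 := by
  have key : ∑ i, c i * ⟪(a i).2, b.2⟫ = 0 := by
    simpa only [sum_inner, real_inner_smul_left, inner_zero_left] using
      congrArg (fun v => ⟪v, b.2⟫) hc
  simp only [kerF, hx, mul_left_comm (c _), ← Finset.mul_sum, key, mul_zero]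

/-- A varifold that pairs to zero with the kernel sections at its own atoms has vanishing
quadratic form. -/
theorem QformF_eq_zero_of_pairing {n : ℕ} {ρ γ : ℝ → ℝ} {ι : Type} [Fintype ι]
    {a : ι → Euc n × Euc n} {c : ι → ℝ}
    (h : ∀ j, ∑ i, c i * kerF n ρ γ (a i) (a j) = 0) : QformF ρ γ a c = 0 := by
  rw [QformF, Finset.sum_comm]
  refine Finset.sum_eq_zero fun j _ => ?_
  simp only [mul_comm (c _) (c j), mul_assoc, ← Finset.mul_sum, h, mul_zero]

/-- for the linear kernel `γ(u) = u` and arbitrary `ρ`, at every `x ∈ ℝⁿ`: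
(a) `δ_{(x,d)} + δ_{(x,-d)}` pairs to zero with every kernel section and has vanishing
quadratic form; (b) for `d₁ ≠ -d₂`, `δ_{(x,d₁)} + δ_{(x,d₂)} - |d₁+d₂| δ_{(x,(d₁+d₂)/|d₁+d₂|)}`
pairs to zero with every kernel section and has vanishing quadratic form. Hence the linear
kernel yields only a pseudo-metric on discrete varifolds. -/
theorem stmt5 (n : ℕ) (hn : 1 ≤ n) (ρ : ℝ → ℝ) (x : Euc n) :
    (∀ d : Euc n, ‖d‖ = 1 →
      (∀ (y e : Euc n), ‖e‖ = 1 →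
          kerF n ρ (fun u => u) (x, d) (y, e) + kerF n ρ (fun u => u) (x, -d) (y, e) = 0) ∧
        QformF ρ (fun u => u) ![(x, d), (x, -d)] ![1, 1] = 0) ∧
    (∀ d₁ d₂ : Euc n, ‖d₁‖ = 1 → ‖d₂‖ = 1 → d₁ ≠ -d₂ →
      (∀ (y e : Euc n), ‖e‖ = 1 →
          kerF n ρ (fun u => u) (x, d₁) (y, e) + kerF n ρ (fun u => u) (x, d₂) (y, e)
            - ‖d₁ + d₂‖ * kerF n ρ (fun u => u) (x, ‖d₁ + d₂‖⁻¹ • (d₁ + d₂)) (y, e) = 0) ∧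
        QformF ρ (fun u => u)
          ![(x, d₁), (x, d₂), (x, ‖d₁ + d₂‖⁻¹ • (d₁ + d₂))] ![1, 1, -‖d₁ + d₂‖] = 0) := by
  refine ⟨fun d _ => ?_, fun d₁ d₂ _ _ hne => ?_⟩
  · have pairing := sum_mul_kerF_linear_eq_zero ρ ![(x, d), (x, -d)] ![1, 1] x
      (by simp [Fin.forall_fin_two]) (by simp)
    exact ⟨fun y e _ => by simpa using pairing (y, e),
      QformF_eq_zero_of_pairing fun j => pairing _⟩
  · have hnorm : ‖d₁ + d₂‖ ≠ 0 := fun h =>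
      hne (eq_neg_of_add_eq_zero_left (norm_eq_zero.mp h))
    have pairing := sum_mul_kerF_linear_eq_zero ρ
      ![(x, d₁), (x, d₂), (x, ‖d₁ + d₂‖⁻¹ • (d₁ + d₂))] ![1, 1, -‖d₁ + d₂‖] x
      (by simp [Fin.forall_fin_succ])
      (by
        simp only [Fin.sum_univ_three, Matrix.cons_val, one_smul, neg_smul]
        rw [smul_inv_smul₀ hnorm, add_neg_cancel])
    exact ⟨fun y e _ => by
        simpa [Fin.sum_univ_three, sub_eq_add_neg] using pairing (y, e),
      QformF_eq_zero_of_pairing fun j => pairing _⟩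
end
end

section
/- Let γ be the Binet kernel function γ(u) = u², and let ρ : [0,∞) → ℝ be arbitrary. Then for every x ∈ ℝⁿ and any two orthonormal bases (d₁,…,dₙ) and (d₁',…,dₙ') of ℝⁿ, the pairings with every kernel section coincide: Σ_{i=1}^n k((x,d_i),(y,e)) = Σ_{i=1}^n k((x,d_i'),(y,e)) = ρ(|x−y|²) for all (y,e) ∈ ℝⁿ × S^{n−1}, and consequently Q(Σ_{i=1}^n δ_{(x,d_i)} − Σ_{i=1}^n δ_{(x,d_i')}) = 0. In particular the Binet kernel yields only a pseudo-metric on the set of discrete varifolds carrying several directions at one position. -/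
open scoped RealInnerProductSpace

noncomputable section

/-- The Binet kernel sections along an orthonormal basis at one position add up to
`ρ(|x-y|²) |e|²`, by Parseval's identity. -/
lemma sum_kerF_sq_orthonormalBasis (n : ℕ) (ρ : ℝ → ℝ) (x y e : Euc n)
    (b : OrthonormalBasis (Fin n) ℝ (Euc n)) :
    ∑ i, kerF n ρ (fun u => u ^ 2) (x, b i) (y, e) = ρ (‖x - y‖ ^ 2) * ‖e‖ ^ 2 := by
  simp only [kerF, ← Finset.mul_sum, b.sum_sq_inner_right]

/-- for the Binet kernel `γ(u) = u²` and arbitrary `ρ`, for every `x ∈ ℝⁿ` and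
any two orthonormal bases `(d₁,…,dₙ)`, `(d₁',…,dₙ')` of `ℝⁿ`, the pairings with every kernel
section coincide: `Σᵢ k((x,dᵢ),(y,e)) = Σᵢ k((x,dᵢ'),(y,e)) = ρ(|x-y|²)` for all unit `e`,
and consequently `Q(Σᵢ δ_{(x,dᵢ)} - Σᵢ δ_{(x,dᵢ')}) = 0`. -/
theorem stmt6 (n : ℕ) (hn : 1 ≤ n) (ρ : ℝ → ℝ) (x : Euc n)
    (b b' : OrthonormalBasis (Fin n) ℝ (Euc n)) :
    (∀ (y e : Euc n), ‖e‖ = 1 →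
        (∑ i, kerF n ρ (fun u => u ^ 2) (x, b i) (y, e) = ρ (‖x - y‖ ^ 2) ∧
         ∑ i, kerF n ρ (fun u => u ^ 2) (x, b' i) (y, e) = ρ (‖x - y‖ ^ 2))) ∧
      QformF ρ (fun u => u ^ 2)
        (Sum.elim (fun i : Fin n => (x, b i)) (fun i : Fin n => (x, b' i)))
        (Sum.elim (fun _ => (1 : ℝ)) (fun _ => (-1 : ℝ))) = 0 := by
  have key (b : OrthonormalBasis (Fin n) ℝ (Euc n)) (y e : Euc n) (he : ‖e‖ = 1) :
      ∑ i, kerF n ρ (fun u => u ^ 2) (x, b i) (y, e) = ρ (‖x - y‖ ^ 2) := by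
    simp [sum_kerF_sq_orthonormalBasis, he]
  refine ⟨fun y e he => ⟨key b y e he, key b' y e he⟩, ?_⟩
  unfold QformF
  rw [Finset.sum_comm]
  refine Finset.sum_eq_zero fun j _ => ?_
  rcases j with j | j
  · simp [Fintype.sum_sum_type, key, b.norm_eq_one]
  · simp [Fintype.sum_sum_type, key, b'.norm_eq_one]
end
end

section
/- Let n ≥ 2 and N ≥ 1. Let x₁,…,x_N ∈ ℝⁿ be pairwise distinct, y₁,…,y_N ∈ ℝⁿ be pairwise distinct, let d₁,…,d_N ∈ S^{n−1} and let w₁,…,w_N ∈ ℝⁿ be nonzero vectors. Then there exists a C^∞ diffeomorphism φ of ℝⁿ such that φ(x_i) = y_i and D_{x_i}φ(d_i) = w_i for every i = 1,…,N. In particular, the pushforward action of the diffeomorphism group is transitive on the set of discrete varifolds with N atoms having pairwise distinct positions and one direction per position: any Σ_{i=1}^N r_i δ_{(x_i,d_i)} can be mapped to any Σ_{i=1}^N s_i δ_{(y_i,u_i)} (r_i, s_i > 0, u_i ∈ S^{n−1}). -/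
noncomputable section

/-- A `C^∞` diffeomorphism of `ℝⁿ`: a smooth bijection with smooth inverse. -/
def IsSmoothDiffeo {n : ℕ} (φ : Euc n → Euc n) : Prop :=
  ContDiff ℝ (⊤ : ℕ∞) φ ∧ ∃ φinv : Euc n → Euc n, ContDiff ℝ (⊤ : ℕ∞) φinv ∧
    Function.LeftInverse φinv φ ∧ Function.RightInverse φinv φ

/-- Hermite interpolation of vector values and derivatives inside the kernel of a functional. -/
theorem exists_contDiff_hermite {E : Type*} [NormedAddCommGroup E] [NormedSpace ℝ E]
    {N : ℕ} (l : E →L[ℝ] ℝ) (t : Fin N → ℝ) (ht : Function.Injective t) (a b : Fin N → E)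
    (ha : ∀ i, l (a i) = 0) (hb : ∀ i, l (b i) = 0) :
    ∃ F : ℝ → E, ContDiff ℝ (⊤ : ℕ∞) F ∧ (∀ s, l (F s) = 0) ∧
      ∀ i, F (t i) = a i ∧ HasDerivAt F (b i) (t i) := by
  set L : Fin N → Polynomial ℝ := fun j => Lagrange.basis Finset.univ t j
  have hself : ∀ i, (L i).eval (t i) = 1 := fun i =>
    Lagrange.eval_basis_self ht.injOn (Finset.mem_univ i)
  have hne : ∀ i j, j ≠ i → (L j).eval (t i) = 0 := fun i j hij =>
    Lagrange.eval_basis_of_ne hij (Finset.mem_univ i)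
  set c : Fin N → E := fun j => b j - (2 * (L j).derivative.eval (t j)) • a j with hc
  refine ⟨fun s => ∑ j, ((L j).eval s ^ 2) • (a j + (s - t j) • c j), ?_, ?_, fun i => ⟨?_, ?_⟩⟩
  · have hL : ∀ j, ContDiff ℝ (⊤ : ℕ∞) fun s : ℝ => (L j).eval s := fun j => by
      simpa using (L j).contDiff_aeval (𝕜 := ℝ) (⊤ : ℕ∞)
    fun_prop
  · intro s
    simp [hc, ha, hb]
  · dsimp only
    rw [Finset.sum_eq_single i (fun j _ hj => by simp [hne i j hj]) (by simp)]
    simp [hself]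
  · have hterm : ∀ j, HasDerivAt (fun s => ((L j).eval s ^ 2) • (a j + (s - t j) • c j))
        ((L j).eval (t i) ^ 2 • c j +
          (2 * (L j).eval (t i) * (L j).derivative.eval (t i)) • (a j + (t i - t j) • c j))
        (t i) := by
      intro j
      have h1 := ((L j).hasDerivAt (t i)).pow 2
      have h2 : HasDerivAt (fun s => a j + (s - t j) • c j) (c j) (t i) := by
        simpa using (((hasDerivAt_id (t i)).sub_const (t j)).smul_const (c j)).const_add (a j)
      convert h1.smul h2 using 2 <;> simp
    have hsum := HasDerivAt.fun_sum (u := Finset.univ) fun j _ => hterm j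
    rw [Finset.sum_eq_single i (fun j _ hj => by simp [hne i j hj]) (by simp)] at hsum
    simpa [hself, hc] using hsum

theorem IsSmoothDiffeo.comp {n : ℕ} {φ ψ : Euc n → Euc n} (hψ : IsSmoothDiffeo ψ)
    (hφ : IsSmoothDiffeo φ) : IsSmoothDiffeo (ψ ∘ φ) := by
  obtain ⟨hψ, ψ', hψ', hψl, hψr⟩ := hψ
  obtain ⟨hφ, φ', hφ', hφl, hφr⟩ := hφ
  exact ⟨hψ.comp hφ, φ' ∘ ψ', hφ'.comp hψ', hψl.comp hφl, hψr.comp hφr⟩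

theorem isSmoothDiffeo_shear {n : ℕ} (l : Euc n →L[ℝ] ℝ) {F : ℝ → Euc n}
    (hF : ContDiff ℝ (⊤ : ℕ∞) F) (hl : ∀ s, l (F s) = 0) :
    IsSmoothDiffeo fun p => p + F (l p) := by
  have hFl : ContDiff ℝ (⊤ : ℕ∞) fun p => F (l p) := hF.comp l.contDiff
  refine ⟨contDiff_id.add hFl, fun p => p - F (l p), contDiff_id.sub hFl, ?_, ?_⟩ <;>
  · intro p
    simp [hl]

/-- A shear along the kernel of `l` adjusts the kernel components of finitely many tangent vectors
that are transverse to the kernel and whose base points lie on distinct level sets of `l`. -/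
theorem exists_shear {n N : ℕ} (l : Euc n →L[ℝ] ℝ) (x x' d d' : Fin N → Euc n)
    (hinj : Function.Injective fun i => l (x i)) (hd : ∀ i, l (d i) ≠ 0)
    (hx' : ∀ i, l (x' i) = l (x i)) (hd' : ∀ i, l (d' i) = l (d i)) :
    ∃ φ : Euc n → Euc n, IsSmoothDiffeo φ ∧
      ∀ i, φ (x i) = x' i ∧ fderiv ℝ φ (x i) (d i) = d' i := by
  obtain ⟨F, hF, hlF, h⟩ := exists_contDiff_hermite l (fun i => l (x i)) hinj
    (fun i => x' i - x i) (fun i => (l (d i))⁻¹ • (d' i - d i))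
    (by simp [hx']) (by simp [hd'])
  refine ⟨fun p => p + F (l p), isSmoothDiffeo_shear l hF hlF, fun i => ⟨?_, ?_⟩⟩
  · simp [(h i).1]
  · have hderiv : HasFDerivAt (fun p => p + F (l p)) _ (x i) :=
      (hasFDerivAt_id (x i)).add ((h i).2.hasFDerivAt.comp (x i) l.hasFDerivAt)
    rw [hderiv.fderiv]
    simp [smul_smul, hd i]

theorem exists_diffeo_of_trans {n N : ℕ} {x x' x'' d d' d'' : Fin N → Euc n}
    (h : ∃ φ : Euc n → Euc n, IsSmoothDiffeo φ ∧
      ∀ i, φ (x i) = x' i ∧ fderiv ℝ φ (x i) (d i) = d' i)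
    (hstep : ∃ φ : Euc n → Euc n, IsSmoothDiffeo φ ∧
      ∀ i, φ (x' i) = x'' i ∧ fderiv ℝ φ (x' i) (d' i) = d'' i) :
    ∃ φ : Euc n → Euc n, IsSmoothDiffeo φ ∧
      ∀ i, φ (x i) = x'' i ∧ fderiv ℝ φ (x i) (d i) = d'' i := by
  obtain ⟨φ, hφ, h⟩ := h
  obtain ⟨ψ, hψ, hstep⟩ := hstep
  refine ⟨ψ ∘ φ, hψ.comp hφ, fun i => ⟨by simp [(h i).1, (hstep i).1], ?_⟩⟩
  rw [fderiv_comp _ (hψ.1.differentiable (by simp) _) (hφ.1.differentiable (by simp) _)]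
  simp [(h i).1, (h i).2, (hstep i).2]

/-- A linear functional separating both families of points and vanishing on no given vector. -/
theorem exists_separating_functional {n N : ℕ} (x y d w : Fin N → Euc n)
    (hx : Function.Injective x) (hy : Function.Injective y)
    (hd : ∀ i, d i ≠ 0) (hw : ∀ i, w i ≠ 0) :
    ∃ l : Euc n →L[ℝ] ℝ, (Function.Injective fun i => l (x i)) ∧
      (Function.Injective fun i => l (y i)) ∧ (∀ i, l (d i) ≠ 0) ∧ ∀ i, l (w i) ≠ 0 := by
  let ι := {p : Fin N × Fin N // p.1 ≠ p.2}
  obtain ⟨f, hf⟩ := Module.exists_dual_forall_apply_ne_zero (K := ℝ)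
    (Sum.elim (Sum.elim (fun p : ι => x p.1.1 - x p.1.2) fun p : ι => y p.1.1 - y p.1.2)
      (Sum.elim d w)) (by
    rintro ((⟨p, hp⟩ | ⟨p, hp⟩) | (i | i))
    · simpa [sub_eq_zero] using hx.ne hp
    · simpa [sub_eq_zero] using hy.ne hp
    · exact hd i
    · exact hw i)
  refine ⟨LinearMap.toContinuousLinearMap f, fun i j hij => ?_, fun i j hij => ?_,
    fun i => hf (.inr (.inl i)), fun i => hf (.inr (.inr i))⟩
  · by_contra hne
    exact hf (.inl (.inl ⟨(i, j), hne⟩)) (by simpa [sub_eq_zero] using hij)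
  · by_contra hne
    exact hf (.inl (.inr ⟨(i, j), hne⟩)) (by simpa [sub_eq_zero] using hij)

/-- Diffeomorphisms act transitively on finite families of nonzero tangent vectors with distinct
base points. -/
theorem exists_diffeo_map_tangent {n N : ℕ} (hn : 2 ≤ n) (hN : 1 ≤ N)
    (x y d w : Fin N → Euc n) (hx : Function.Injective x) (hy : Function.Injective y)
    (hd : ∀ i, d i ≠ 0) (hw : ∀ i, w i ≠ 0) :
    ∃ φ : Euc n → Euc n, IsSmoothDiffeo φ ∧
      ∀ i, φ (x i) = y i ∧ fderiv ℝ φ (x i) (d i) = w i := by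
  obtain ⟨l, hlx, hly, hld, hlw⟩ := exists_separating_functional x y d w hx hy hd hw
  obtain ⟨e, hle, he⟩ : ∃ e, l e = 0 ∧ e ≠ 0 := by
    have hker : LinearMap.ker l.toLinearMap ≠ ⊥ :=
      LinearMap.ker_ne_bot_of_finrank_lt (by simp; omega)
    simpa using Submodule.exists_mem_ne_zero_of_ne_bot hker
  obtain ⟨v, hlv⟩ : ∃ v, l v = 1 :=
    ⟨(l (d ⟨0, hN⟩))⁻¹ • d ⟨0, hN⟩, by simp [hld]⟩
  obtain ⟨m, hme⟩ := SeparatingDual.exists_eq_one (R := ℝ) he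
  obtain ⟨k, hke, hkv⟩ : ∃ k : Euc n →L[ℝ] ℝ, k e = 1 ∧ k v = 0 :=
    ⟨m - m v • l, by simp [hme, hle], by simp [hlv]⟩
  have hcast : Function.Injective fun i : Fin N => ((i : ℕ) : ℝ) :=
    Nat.cast_injective.comp Fin.val_injective
  refine exists_diffeo_of_trans (exists_shear l x (fun i => ((i : ℕ) : ℝ) • e + l (x i) • v) d
    (fun i => e + l (d i) • v) hlx hld (by simp [hle, hlv]) (by simp [hle, hlv])) ?_
  refine exists_diffeo_of_trans (exists_shear k _ (fun i => ((i : ℕ) : ℝ) • e + l (y i) • v) _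
    (fun i => e + l (w i) • v) (by simpa [hke, hkv] using hcast) (by simp [hke, hkv])
    (by simp [hkv]) (by simp [hkv])) ?_
  exact exists_shear l _ y _ w (by simpa [hle, hlv] using hly) (by simpa [hle, hlv] using hlw)
    (by simp [hle, hlv]) (by simp [hle, hlv])

/-- for `n ≥ 2`, pairwise distinct positions `xᵢ`, `yᵢ`, unit directions `dᵢ`
and nonzero target vectors `wᵢ`, there is a `C^∞` diffeomorphism `φ` of `ℝⁿ` with
`φ(xᵢ) = yᵢ` and `D_{xᵢ}φ(dᵢ) = wᵢ` for all `i`. In particular the pushforward action of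
the diffeomorphism group is transitive on discrete varifolds with `N` atoms having pairwise
distinct positions and one direction per position: choosing `wᵢ = (sᵢ/rᵢ) uᵢ`, the varifold
`Σ rᵢ δ_{(xᵢ,dᵢ)}` is mapped to `Σ sᵢ δ_{(yᵢ,uᵢ)}`. -/
theorem stmt9 (n N : ℕ) (hn : 2 ≤ n) (hN : 1 ≤ N)
    (x y : Fin N → Euc n) (hx : Function.Injective x) (hy : Function.Injective y)
    (d : Fin N → Euc n) (hd : ∀ i, ‖d i‖ = 1)
    (w : Fin N → Euc n) (hw : ∀ i, w i ≠ 0) :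
    (∃ φ : Euc n → Euc n, IsSmoothDiffeo φ ∧
        ∀ i, φ (x i) = y i ∧ fderiv ℝ φ (x i) (d i) = w i) ∧
      ∀ (r s : Fin N → ℝ), (∀ i, 0 < r i) → (∀ i, 0 < s i) →
        ∀ u : Fin N → Euc n, (∀ i, ‖u i‖ = 1) →
          ∃ φ : Euc n → Euc n, IsSmoothDiffeo φ ∧
            ∀ i, φ (x i) = y i ∧
              r i * ‖fderiv ℝ φ (x i) (d i)‖ = s i ∧
              ‖fderiv ℝ φ (x i) (d i)‖⁻¹ • fderiv ℝ φ (x i) (d i) = u i := by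
  have hd0 : ∀ i, d i ≠ 0 := fun i h => by simpa [h] using hd i
  refine ⟨exists_diffeo_map_tangent hn hN x y d w hx hy hd0 hw, fun r s hr hs u hu => ?_⟩
  have hpos : ∀ i, 0 < s i / r i := fun i => div_pos (hs i) (hr i)
  have hu0 : ∀ i, u i ≠ 0 := fun i h => by simpa [h] using hu i
  obtain ⟨φ, hφ, h⟩ := exists_diffeo_map_tangent hn hN x y d (fun i => (s i / r i) • u i) hx hy hd0
    fun i => smul_ne_zero (hpos i).ne' (hu0 i)
  refine ⟨φ, hφ, fun i => ⟨(h i).1, ?_⟩⟩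
  have hnorm : ‖(s i / r i) • u i‖ = s i / r i := by
    rw [norm_smul, hu, mul_one, Real.norm_of_nonneg (hpos i).le]
  rw [(h i).2, hnorm]
  exact ⟨mul_div_cancel₀ _ (hr i).ne', inv_smul_smul₀ (hpos i).ne' _⟩
end
end

section
/- Transport of a tangent direction under a flow: let v : [0,1] × ℝⁿ → ℝⁿ be such that each v_t is continuously differentiable in the space variable, let x : [0,1] → ℝⁿ be differentiable with ẋ(t) = v_t(x(t)), and let A : [0,1] → ℝ^{n×n} be differentiable with A(0) = Id and A'(t) = D_{x(t)}v_t ∘ A(t). Fix d₀ ∈ S^{n−1} and assume A(t)d₀ ≠ 0 for all t. Then d(t) := A(t)d₀/|A(t)d₀| is differentiable and satisfies ḋ(t) = P_{d(t)^⊥}(D_{x(t)}v_t(d(t))) for all t ∈ [0,1], where P_{e^⊥}(w) = w − ⟨w,e⟩e denotes the orthogonal projection onto the hyperplane orthogonal to the unit vector e. -/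
open scoped RealInnerProductSpace

noncomputable section

/-- The derivative of the normalization of a curve is the normalized derivative, projected onto
the hyperplane orthogonal to the curve. -/
theorem HasDerivAt.inv_norm_smul_self {E : Type*} [NormedAddCommGroup E] [InnerProductSpace ℝ E]
    {f : ℝ → E} {f' : E} {t : ℝ} (hf : HasDerivAt f f' t) (h0 : f t ≠ 0) :
    HasDerivAt (fun s => ‖f s‖⁻¹ • f s)
      (‖f t‖⁻¹ • f' - ⟪‖f t‖⁻¹ • f', ‖f t‖⁻¹ • f t⟫ • (‖f t‖⁻¹ • f t)) t := by
  have hpos : ‖f t‖ ≠ 0 := norm_ne_zero_iff.mpr h0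
  have hnorm : HasDerivAt (fun s => ‖f s‖) (⟪f t, f'⟫ / ‖f t‖) t := by
    have h := hf.norm_sq.sqrt (pow_ne_zero 2 hpos)
    simp only [Real.sqrt_sq (norm_nonneg _)] at h
    rwa [mul_div_mul_left _ _ two_ne_zero] at h
  convert (hnorm.fun_inv hpos).fun_smul hf using 1
  rw [real_inner_smul_left, real_inner_smul_right, real_inner_comm, smul_smul, sub_eq_add_neg,
    ← neg_smul]
  congr 2
  field_simp

/-- transport of a tangent direction under a flow. If `ẋ(t) = v_t(x(t))`,
`A(0) = Id`, `A'(t) = D_{x(t)}v_t ∘ A(t)` and `A(t)d₀ ≠ 0`, then the normalized direction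
`d(t) = A(t)d₀ / |A(t)d₀|` satisfies `ḋ(t) = P_{d(t)⊥}(D_{x(t)}v_t(d(t)))`, where
`P_{e⊥}(w) = w - ⟨w,e⟩e`. -/
theorem stmt11 (n : ℕ) (hn : 1 ≤ n)
    (v : ℝ → Euc n → Euc n) (hv : ∀ t ∈ Set.Icc (0:ℝ) 1, ContDiff ℝ 1 (v t))
    (x : ℝ → Euc n) (hx : ∀ t ∈ Set.Icc (0:ℝ) 1, HasDerivAt x (v t (x t)) t)
    (A : ℝ → (Euc n →L[ℝ] Euc n))
    (hA0 : A 0 = ContinuousLinearMap.id ℝ (Euc n))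
    (hA : ∀ t ∈ Set.Icc (0:ℝ) 1,
        HasDerivAt A ((fderiv ℝ (v t) (x t)).comp (A t)) t)
    (d₀ : Euc n) (hd₀ : ‖d₀‖ = 1) (hAd : ∀ t ∈ Set.Icc (0:ℝ) 1, A t d₀ ≠ 0) :
    ∀ t ∈ Set.Icc (0:ℝ) 1,
      HasDerivAt (fun s => ‖A s d₀‖⁻¹ • A s d₀)
        (fderiv ℝ (v t) (x t) (‖A t d₀‖⁻¹ • A t d₀)
          - ⟪fderiv ℝ (v t) (x t) (‖A t d₀‖⁻¹ • A t d₀), ‖A t d₀‖⁻¹ • A t d₀⟫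
            • (‖A t d₀‖⁻¹ • A t d₀)) t := by
  intro t ht
  have h := ((hA t ht).clm_apply (hasDerivAt_const t d₀)).inv_norm_smul_self (hAd t ht)
  simpa only [map_zero, add_zero, ContinuousLinearMap.comp_apply, map_smul] using h
end
end

section
/- Transport of a normal direction under a flow: let v : [0,1] × ℝⁿ → ℝⁿ be such that each v_t is continuously differentiable in the space variable, let x : [0,1] → ℝⁿ be differentiable with ẋ(t) = v_t(x(t)), and let A : [0,1] → ℝ^{n×n} be differentiable with A(0) = Id, A'(t) = D_{x(t)}v_t ∘ A(t), and A(t) invertible for all t. Fix d₀ ∈ S^{n−1} and set d(t) := A(t)^{-T} d₀ / |A(t)^{-T} d₀| (where A^{-T} is the inverse transpose). Then d is differentiable and satisfies ḋ(t) = P_{d(t)^⊥}(−(D_{x(t)}v_t)^T d(t)) for all t ∈ [0,1], where P_{e^⊥}(w) = w − ⟨w,e⟩e denotes the orthogonal projection onto the hyperplane orthogonal to the unit vector e. -/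
open scoped RealInnerProductSpace

noncomputable section

/-- Derivative of the pointwise inverse of a curve of continuous linear automorphisms. -/
theorem hasDerivAt_clm_symm {E : Type*} [NormedAddCommGroup E] [NormedSpace ℝ E] [CompleteSpace E]
    {A : ℝ → (E ≃L[ℝ] E)} {A' : E →L[ℝ] E} {t : ℝ}
    (hA : HasDerivAt (fun s => (A s : E →L[ℝ] E)) A' t) :
    HasDerivAt (fun s => ((A s).symm : E →L[ℝ] E))
      (-(((A t).symm : E →L[ℝ] E) * A' * ((A t).symm : E →L[ℝ] E))) t := by
  have hinv : HasFDerivAt (Ring.inverse : (E →L[ℝ] E) → (E →L[ℝ] E)) _ (A t : E →L[ℝ] E) :=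
    hasFDerivAt_ringInverse (𝕜 := ℝ) (ContinuousLinearEquiv.toUnit (A t))
  have h := hinv.comp_hasDerivAt t hA
  have hfun : (Ring.inverse ∘ fun s => (A s : E →L[ℝ] E)) =
      fun s => ((A s).symm : E →L[ℝ] E) := by
    funext s
    exact Ring.inverse_unit (ContinuousLinearEquiv.toUnit (A s))
  rw [hfun] at h
  exact h

/-- The derivative of a normalized nonvanishing curve is the projection of the scaled velocity
onto the orthogonal complement of the direction. -/
theorem HasDerivAt.normalize_of_ne_zero {E : Type*} [NormedAddCommGroup E]
    [InnerProductSpace ℝ E] {p : ℝ → E} {p' : E} {t : ℝ} (hp : HasDerivAt p p' t)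
    (h0 : p t ≠ 0) :
    HasDerivAt (fun s => ‖p s‖⁻¹ • p s)
      (‖p t‖⁻¹ • p' - ⟪‖p t‖⁻¹ • p', ‖p t‖⁻¹ • p t⟫ • (‖p t‖⁻¹ • p t)) t := by
  have hn : ‖p t‖ ≠ 0 := norm_ne_zero_iff.mpr h0
  have hnorm : HasDerivAt (fun s => ‖p s‖) (⟪p t, p'⟫ / ‖p t‖) t := by
    have h := hp.norm_sq.sqrt (pow_ne_zero 2 hn)
    simp only [Real.sqrt_sq (norm_nonneg _)] at h
    convert h using 1
    field_simp
  refine ((hnorm.inv hn).smul hp).congr_deriv ?_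
  rw [Pi.inv_apply]
  simp only [inner_smul_left, inner_smul_right, smul_smul, real_inner_comm (p t) p',
    RCLike.conj_to_real, sub_eq_add_neg, ← neg_smul]
  congr 2
  field_simp

/-- transport of a normal direction under a flow. If `ẋ(t) = v_t(x(t))`,
`A(0) = Id`, `A'(t) = D_{x(t)}v_t ∘ A(t)` with `A(t)` invertible for all `t`, then
`d(t) = A(t)^{-T} d₀ / |A(t)^{-T} d₀|` satisfies
`ḋ(t) = P_{d(t)⊥}(-(D_{x(t)}v_t)^T d(t))`, where `P_{e⊥}(w) = w - ⟨w,e⟩e` and the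
transpose is the adjoint for the Euclidean inner product. -/
theorem stmt13 (n : ℕ) (hn : 1 ≤ n)
    (v : ℝ → Euc n → Euc n) (hv : ∀ t ∈ Set.Icc (0:ℝ) 1, ContDiff ℝ 1 (v t))
    (x : ℝ → Euc n) (hx : ∀ t ∈ Set.Icc (0:ℝ) 1, HasDerivAt x (v t (x t)) t)
    (A : ℝ → (Euc n ≃L[ℝ] Euc n))
    (hA0 : A 0 = ContinuousLinearEquiv.refl ℝ (Euc n))
    (hA : ∀ t ∈ Set.Icc (0:ℝ) 1,
        HasDerivAt (fun s => ((A s : Euc n →L[ℝ] Euc n)))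
          ((fderiv ℝ (v t) (x t)).comp (A t : Euc n →L[ℝ] Euc n)) t)
    (d₀ : Euc n) (hd₀ : ‖d₀‖ = 1) :
    ∀ t ∈ Set.Icc (0:ℝ) 1,
      HasDerivAt
        (fun s => ‖ContinuousLinearMap.adjoint ((A s).symm : Euc n →L[ℝ] Euc n) d₀‖⁻¹
          • ContinuousLinearMap.adjoint ((A s).symm : Euc n →L[ℝ] Euc n) d₀)
        (let d : Euc n := ‖ContinuousLinearMap.adjoint ((A t).symm : Euc n →L[ℝ] Euc n) d₀‖⁻¹
            • ContinuousLinearMap.adjoint ((A t).symm : Euc n →L[ℝ] Euc n) d₀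
          let w : Euc n := -(ContinuousLinearMap.adjoint (fderiv ℝ (v t) (x t)) d)
          w - ⟪w, d⟫ • d) t := by
  intro t ht
  have hB := hasDerivAt_clm_symm (hA t ht)
  have hp : HasDerivAt
      (fun s => ContinuousLinearMap.adjoint ((A s).symm : Euc n →L[ℝ] Euc n) d₀)
      (-(ContinuousLinearMap.adjoint (fderiv ℝ (v t) (x t))
        (ContinuousLinearMap.adjoint ((A t).symm : Euc n →L[ℝ] Euc n) d₀))) t := by
    have hB' : -(((A t).symm : Euc n →L[ℝ] Euc n) *
        ((fderiv ℝ (v t) (x t)).comp (A t : Euc n →L[ℝ] Euc n)) *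
        ((A t).symm : Euc n →L[ℝ] Euc n)) =
        -(((A t).symm : Euc n →L[ℝ] Euc n).comp (fderiv ℝ (v t) (x t))) := by
      ext1 y
      simp
    rw [hB'] at hB
    have h := hB.star.clm_apply (hasDerivAt_const t d₀)
    simpa [ContinuousLinearMap.star_eq_adjoint, ContinuousLinearMap.adjoint_comp] using h
  have h0 : ContinuousLinearMap.adjoint ((A t).symm : Euc n →L[ℝ] Euc n) d₀ ≠ 0 := by
    intro h
    have h1 := ContinuousLinearMap.adjoint_inner_left
      ((A t).symm : Euc n →L[ℝ] Euc n) (A t d₀) d₀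
    rw [h] at h1
    simp [hd₀] at h1
  have h := hp.normalize_of_ne_zero h0
  simpa only [map_smul, smul_neg] using h
end
end

section
/- (Forward direction of the reduction proposition.) Let (x_i, u_i, P_i^{(1)}, P_i^{(2)})_{i=1,…,P} : [0,1] → (ℝⁿ)⁴ be a C¹ solution of the reduced Hamiltonian system with u_i(t) ≠ 0 for all i and t. Then the curves defined by x_i(t), d_i(t) := u_i(t)/|u_i(t)|, r_i(t) := |u_i(t)|, p_i^{(1)}(t) := P_i^{(1)}(t), p_i^{(2)}(t) := |u_i(t)| P_i^{(2)}(t), p_i^{(3)}(t) := ⟨P_i^{(2)}(t), u_i(t)/|u_i(t)|⟩ form a solution of the full Hamiltonian system, and moreover the vector field v_t of the full system coincides with the vector field V_t of the reduced system. -/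
open scoped RealInnerProductSpace

noncomputable section

/-- Orthogonal projection `P_{e⊥}(w) = w - ⟨w,e⟩e` onto the hyperplane orthogonal to the
unit vector `e`. -/
def projPerp {n : ℕ} (e w : Euc n) : Euc n := w - ⟪w, e⟫ • e

/-- `D₁K(x,y)(u₁,u₂)`: derivative at `x`, in the direction `u₁`, of `z ↦ K(z,y)u₂`. -/
def D1K {n : ℕ} (K : Euc n → Euc n → (Euc n →L[ℝ] Euc n)) (x y u₁ u₂ : Euc n) : Euc n :=
  fderiv ℝ (fun z => K z y u₂) x u₁

/-- `(D_x f)^T`, the transpose (Euclidean adjoint) of the Jacobian of `f` at `x`. -/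
def DxT {n : ℕ} (f : Euc n → Euc n) (x : Euc n) : Euc n →L[ℝ] Euc n :=
  ContinuousLinearMap.adjoint (fderiv ℝ f x)

/-- `(D²_x f(·,u))^T`, the transpose of the derivative at `x` of `z ↦ D_z f(u)`. -/
def D2T {n : ℕ} (f : Euc n → Euc n) (x u : Euc n) : Euc n →L[ℝ] Euc n :=
  ContinuousLinearMap.adjoint (fderiv ℝ (fun z => fderiv ℝ f z u) x)

/-- The vector field of the REDUCED Hamiltonian system:
`V_t(z) = Σ_k K(x_k(t),z) P¹_k(t) + D₁K(x_k(t),z)(u_k(t), P²_k(t))`. -/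
def Vred {n : ℕ} (P : ℕ) (K : Euc n → Euc n → (Euc n →L[ℝ] Euc n))
    (x u P1 P2 : Fin P → ℝ → Euc n) (t : ℝ) (z : Euc n) : Euc n :=
  ∑ k, (K (x k t) z (P1 k t) + D1K K (x k t) z (u k t) (P2 k t))

/-- The vector field of the FULL Hamiltonian system:
`v_t(z) = Σ_k K(x_k(t),z) p¹_k(t)
  + D₁K(x_k(t),z)(d_k(t), P_{d_k⊥}(p²_k(t)) + p³_k(t) r_k(t) d_k(t))`. -/
def vfull {n : ℕ} (P : ℕ) (K : Euc n → Euc n → (Euc n →L[ℝ] Euc n))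
    (x d : Fin P → ℝ → Euc n) (r : Fin P → ℝ → ℝ)
    (p1 p2 : Fin P → ℝ → Euc n) (p3 : Fin P → ℝ → ℝ) (t : ℝ) (z : Euc n) : Euc n :=
  ∑ k, (K (x k t) z (p1 k t)
    + D1K K (x k t) z (d k t) (projPerp (d k t) (p2 k t) + (p3 k t * r k t) • d k t))

/-- The derivative of the norm of a nonvanishing curve. -/
theorem hasDerivAt_norm_of_ne_zero {E : Type*} [NormedAddCommGroup E] [InnerProductSpace ℝ E]
    {f : ℝ → E} {f' : E} {t : ℝ} (hf : HasDerivAt f f' t) (h0 : f t ≠ 0) :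
    HasDerivAt (fun s => ‖f s‖) (‖f t‖⁻¹ * ⟪f t, f'⟫) t := by
  have hn : ‖f t‖ ≠ 0 := norm_ne_zero_iff.mpr h0
  have h := hf.norm_sq.sqrt (pow_ne_zero 2 hn)
  simp only [Real.sqrt_sq (norm_nonneg _)] at h
  convert h using 1
  field_simp

/-- The derivative of the direction of a nonvanishing curve. -/
theorem hasDerivAt_normalize {n : ℕ} {f : ℝ → Euc n} {f' : Euc n} {t : ℝ}
    (hf : HasDerivAt f f' t) (h0 : f t ≠ 0) :
    HasDerivAt (fun s => ‖f s‖⁻¹ • f s)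
      (projPerp (‖f t‖⁻¹ • f t) (‖f t‖⁻¹ • f')) t := by
  have hn : ‖f t‖ ≠ 0 := norm_ne_zero_iff.mpr h0
  refine (((hasDerivAt_norm_of_ne_zero hf h0).fun_inv hn).fun_smul hf).congr_deriv ?_
  simp only [projPerp, inner_smul_left, inner_smul_right, real_inner_comm (f t) f',
    RCLike.conj_to_real]
  match_scalars <;> field_simp

theorem D1K_smul_smul {n : ℕ} (K : Euc n → Euc n → (Euc n →L[ℝ] Euc n)) (x y u₁ u₂ : Euc n)
    (a b : ℝ) : D1K K x y (a • u₁) (b • u₂) = (a * b) • D1K K x y u₁ u₂ := by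
  have h : fderiv ℝ (fun z => b • K z y u₂) x = b • fderiv ℝ (fun z => K z y u₂) x :=
    congrFun (fderiv_const_smul_field b) x
  simp only [D1K, map_smul, h, smul_apply, smul_smul]

theorem D2T_smul {n : ℕ} (f : Euc n → Euc n) (x u : Euc n) (a : ℝ) :
    D2T f x (a • u) = a • D2T f x u := by
  have h : fderiv ℝ (fun z => a • fderiv ℝ f z u) x = a • fderiv ℝ (fun z => fderiv ℝ f z u) x :=
    congrFun (fderiv_const_smul_field a) x
  simp only [D2T, map_smul, h]

/-- In polar coordinates, the tangential and radial parts of the momentum recombine. -/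
theorem projPerp_add_radial {n : ℕ} (u w : Euc n) :
    projPerp (‖u‖⁻¹ • u) (‖u‖ • w) + (⟪w, ‖u‖⁻¹ • u⟫ * ‖u‖) • ‖u‖⁻¹ • u = ‖u‖ • w := by
  rw [projPerp, real_inner_smul_left, mul_comm ‖u‖, sub_add_cancel]

/-- forward direction of the reduction proposition: any solution of the
reduced Hamiltonian system with `u_i(t) ≠ 0` gives, via `d_i = u_i/|u_i|`, `r_i = |u_i|`,
`p¹_i = P¹_i`, `p²_i = |u_i| P²_i`, `p³_i = ⟨P²_i, u_i/|u_i|⟩`, a solution of the full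
Hamiltonian system, and the full vector field coincides with the reduced one. -/
theorem stmt16 (n P : ℕ) (hn : 1 ≤ n) (hP : 1 ≤ P)
    (K : Euc n → Euc n → (Euc n →L[ℝ] Euc n))
    (hK : ContDiff ℝ 2 (fun q : Euc n × Euc n => K q.1 q.2))
    (x u P1 P2 : Fin P → ℝ → Euc n)
    (hC1 : ∀ i, ContDiffOn ℝ 1 (x i) (Set.Icc (0:ℝ) 1) ∧
      ContDiffOn ℝ 1 (u i) (Set.Icc (0:ℝ) 1) ∧
      ContDiffOn ℝ 1 (P1 i) (Set.Icc (0:ℝ) 1) ∧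
      ContDiffOn ℝ 1 (P2 i) (Set.Icc (0:ℝ) 1))
    (hu : ∀ i, ∀ t ∈ Set.Icc (0:ℝ) 1, u i t ≠ 0)
    (hx : ∀ i, ∀ t ∈ Set.Icc (0:ℝ) 1,
        HasDerivAt (x i) (Vred P K x u P1 P2 t (x i t)) t)
    (hud : ∀ i, ∀ t ∈ Set.Icc (0:ℝ) 1,
        HasDerivAt (u i) (fderiv ℝ (Vred P K x u P1 P2 t) (x i t) (u i t)) t)
    (hP1 : ∀ i, ∀ t ∈ Set.Icc (0:ℝ) 1,
        HasDerivAt (P1 i)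
          (-(DxT (Vred P K x u P1 P2 t) (x i t) (P1 i t))
            - D2T (Vred P K x u P1 P2 t) (x i t) (u i t) (P2 i t)) t)
    (hP2 : ∀ i, ∀ t ∈ Set.Icc (0:ℝ) 1,
        HasDerivAt (P2 i) (-(DxT (Vred P K x u P1 P2 t) (x i t) (P2 i t))) t) :
    let d : Fin P → ℝ → Euc n := fun i t => ‖u i t‖⁻¹ • u i t
    let r : Fin P → ℝ → ℝ := fun i t => ‖u i t‖
    let p2 : Fin P → ℝ → Euc n := fun i t => ‖u i t‖ • P2 i t
    let p3 : Fin P → ℝ → ℝ := fun i t => ⟪P2 i t, ‖u i t‖⁻¹ • u i t⟫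
    let vf : ℝ → Euc n → Euc n := vfull P K x d r P1 p2 p3
    (∀ t ∈ Set.Icc (0:ℝ) 1, ∀ z : Euc n, vf t z = Vred P K x u P1 P2 t z) ∧
      ∀ i, ∀ t ∈ Set.Icc (0:ℝ) 1,
        HasDerivAt (x i) (vf t (x i t)) t ∧
        HasDerivAt (d i) (projPerp (d i t) (fderiv ℝ (vf t) (x i t) (d i t))) t ∧
        HasDerivAt (r i) (r i t * ⟪d i t, fderiv ℝ (vf t) (x i t) (d i t)⟫) t ∧
        HasDerivAt (P1 i)
          (-(DxT (vf t) (x i t) (P1 i t))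
            - D2T (vf t) (x i t) (d i t) (projPerp (d i t) (p2 i t))
            - (p3 i t * r i t) • D2T (vf t) (x i t) (d i t) (d i t)) t ∧
        HasDerivAt (p2 i)
          (-(DxT (vf t) (x i t) (p2 i t))
            + (⟪d i t, p2 i t⟫ - r i t * p3 i t)
                • (fderiv ℝ (vf t) (x i t) (d i t) + DxT (vf t) (x i t) (d i t))
            + ⟪d i t, fderiv ℝ (vf t) (x i t) (d i t)⟫ • p2 i t) t ∧
        HasDerivAt (p3 i) (-(p3 i t * ⟪d i t, fderiv ℝ (vf t) (x i t) (d i t)⟫)) t := by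
  intro d r p2 p3 vf
  have hv : ∀ t ∈ Set.Icc (0:ℝ) 1, vf t = Vred P K x u P1 P2 t := by
    intro t ht
    funext z
    refine Finset.sum_congr rfl fun k _ => ?_
    have hn : ‖u k t‖ ≠ 0 := norm_ne_zero_iff.mpr (hu k t ht)
    simp only [d, r, p2, p3]
    rw [projPerp_add_radial, D1K_smul_smul, inv_mul_cancel₀ hn, one_smul]
  refine ⟨fun t ht z => congrFun (hv t ht) z, fun i t ht => ?_⟩
  rw [hv t ht]
  specialize hx i t ht
  specialize hud i t ht
  specialize hP1 i t ht
  specialize hP2 i t ht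
  have h0 := hu i t ht
  have hn : ‖u i t‖ ≠ 0 := norm_ne_zero_iff.mpr h0
  set V := Vred P K x u P1 P2 t
  have hr : HasDerivAt (r i) (r i t * ⟪d i t, fderiv ℝ V (x i t) (d i t)⟫) t := by
    refine (hasDerivAt_norm_of_ne_zero hud h0).congr_deriv ?_
    simp only [r, d, map_smul, real_inner_smul_left, real_inner_smul_right]
    field_simp
  have hd : HasDerivAt (d i) (projPerp (d i t) (fderiv ℝ V (x i t) (d i t))) t := by
    refine (hasDerivAt_normalize hud h0).congr_deriv ?_
    simp only [d, map_smul]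
  refine ⟨hx, hd, hr, ?_, ?_, ?_⟩
  · refine hP1.congr_deriv ?_
    symm
    rw [sub_sub, ← map_smul, ← map_add]
    simp only [d, r, p2, p3]
    rw [projPerp_add_radial, D2T_smul, smul_apply, map_smul,
      inv_smul_smul₀ hn]
  · have hz : ⟪d i t, p2 i t⟫ - r i t * p3 i t = 0 := by
      simp only [d, r, p2, p3, real_inner_smul_right, real_inner_comm (P2 i t)]
      ring
    rw [hz, zero_smul, add_zero]
    refine (hr.fun_smul hP2).congr_deriv ?_
    simp only [p2, r, map_smul]
    module
  · refine (hP2.inner ℝ hd).congr_deriv ?_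
    simp only [projPerp, DxT, inner_sub_right, inner_neg_left, real_inner_smul_right,
      ContinuousLinearMap.adjoint_inner_left, p3, d, map_smul, real_inner_smul_left,
      real_inner_comm (u i t)]
    ring
end
end
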